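/- Let n ≥ 2 be an integer, let μ ≥ 0, and let p be a Legendre function for the pair (n, μ). Then the sign of p(0) equals the sign of cos(μπ/2) and the sign of p'(0) equals the sign of sin(μπ/2); that is: p(0) > 0 if cos(μπ/2) > 0, p(0) < 0 if cos(μπ/2) < 0, p(0) = 0 if cos(μπ/2) = 0, and likewise p'(0) > 0, < 0, or = 0 according as sin(μπ/2) > 0, < 0, or = 0. -/

import Mathlib

open Real Set Filter

/-- `p` is a Legendre function for the pair `(n, μ)`, with derivative `p'` (denoted `p₁`):
`p` is `C¹` on `[0, π/2]`, `C²` on `[0, π/2)`, solves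
`p'' - (n-2)·tan(φ)·p' + μ(μ+n-2)·p = 0` on `[0, π/2)`, and `p(π/2) = 1`, `p'(π/2) = 0`. -/
def IsLegendre (n : ℕ) (μ : ℝ) (p p₁ : ℝ → ℝ) : Prop :=
  (∀ φ ∈ Set.Icc (0 : ℝ) (π / 2), HasDerivWithinAt p (p₁ φ) (Set.Icc 0 (π / 2)) φ) ∧
  ContinuousOn p₁ (Set.Icc 0 (π / 2)) ∧
  (∃ p₂ : ℝ → ℝ,
    (∀ φ ∈ Set.Ico (0 : ℝ) (π / 2), HasDerivWithinAt p₁ (p₂ φ) (Set.Ico 0 (π / 2)) φ) ∧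
    ContinuousOn p₂ (Set.Ico 0 (π / 2)) ∧
    ∀ φ ∈ Set.Ico (0 : ℝ) (π / 2),
      p₂ φ - (n - 2 : ℝ) * Real.tan φ * p₁ φ + μ * (μ + n - 2) * p φ = 0) ∧
  p (π / 2) = 1 ∧ p₁ (π / 2) = 0

namespace LegendreAux

lemma hasDerivAt_cos_pow (m : ℕ) (x : ℝ) (hx : cos x ≠ 0) :
    HasDerivAt (fun y => cos y ^ m) (-(m : ℝ) * tan x * cos x ^ m) x := by
  have h := (Real.hasDerivAt_cos x).pow m
  refine h.congr_deriv ?_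
  rw [tan_eq_sin_div_cos]
  cases m with
  | zero => simp
  | succ k => simp only [Nat.add_sub_cancel, pow_succ]; field_simp

lemma cos_pos' {x : ℝ} (hx : x ∈ Ico (0 : ℝ) (π / 2)) : 0 < cos x :=
  cos_pos_of_mem_Ioo ⟨by linarith [hx.1, pi_pos], hx.2⟩

lemma int1 {m : ℕ} {μ : ℝ} {p p₁ : ℝ → ℝ} (hp : IsLegendre (m + 2) μ p p₁) {x : ℝ}
    (hx : x ∈ Ioo (0 : ℝ) (π / 2)) : HasDerivAt p (p₁ x) x :=
  (hp.1 x ⟨hx.1.le, hx.2.le⟩).hasDerivAt (Icc_mem_nhds hx.1 hx.2)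

lemma int2 {m : ℕ} {μ : ℝ} {p p₁ : ℝ → ℝ} (hp : IsLegendre (m + 2) μ p p₁) {x : ℝ}
    (hx : x ∈ Ioo (0 : ℝ) (π / 2)) :
    HasDerivAt p₁ (m * tan x * p₁ x - μ * (μ + m) * p x) x := by
  obtain ⟨_, _, ⟨p₂, h2, _, ho⟩, _⟩ := hp
  have h := (h2 x ⟨hx.1.le, hx.2⟩).hasDerivAt (Ico_mem_nhds hx.1 hx.2)
  refine h.congr_deriv ?_
  have := ho x ⟨hx.1.le, hx.2⟩
  push_cast at this
  linear_combination this

lemma contp {m : ℕ} {μ : ℝ} {p p₁ : ℝ → ℝ} (hp : IsLegendre (m + 2) μ p p₁) :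
    ContinuousOn p (Icc 0 (π / 2)) := fun x hx => (hp.1 x hx).continuousWithinAt

/-- sign of the derivative from positivity -/
lemma derivA {m : ℕ} {μ : ℝ} {p p₁ : ℝ → ℝ} (hμ : 0 < μ) (hp : IsLegendre (m + 2) μ p p₁) {a : ℝ}
    (ha : a ∈ Ico (0 : ℝ) (π / 2)) (hpos : ∀ x ∈ Ioo a (π / 2), 0 < p x) : 0 < p₁ a := by
  have hanti : StrictAntiOn (fun x => cos x ^ m * p₁ x) (Icc a (π / 2)) := by
    apply strictAntiOn_of_deriv_neg (convex_Icc _ _)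
    · exact (continuous_cos.pow m).continuousOn.mul (hp.2.1.mono (Icc_subset_Icc_left ha.1))
    · intro x hx
      rw [interior_Icc] at hx
      have hx' : x ∈ Ioo (0 : ℝ) (π / 2) := ⟨ha.1.trans_lt hx.1, hx.2⟩
      have hc := cos_pos' ⟨hx'.1.le, hx'.2⟩
      rw [((hasDerivAt_cos_pow m x hc.ne').fun_mul (int2 hp hx')).deriv]
      have h1 : 0 < cos x ^ m * (μ * (μ + m) * p x) := by
        have := hpos x hx
        positivity
      nlinarith
  have h := hanti ⟨le_rfl, ha.2.le⟩ ⟨ha.2.le, le_rfl⟩ ha.2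
  simp only [hp.2.2.2.2, mul_zero] at h
  exact pos_of_mul_pos_right h (pow_pos (cos_pos' ha) m).le

lemma derivZero {m : ℕ} {p p₁ : ℝ → ℝ} (hp : IsLegendre (m + 2) 0 p p₁) {a : ℝ}
    (ha : a ∈ Ico (0 : ℝ) (π / 2)) : p₁ a = 0 := by
  have hd : ∀ x ∈ Ioo a (π / 2), HasDerivAt (fun x => cos x ^ m * p₁ x) 0 x := by
    intro x hx
    have hx' : x ∈ Ioo (0 : ℝ) (π / 2) := ⟨ha.1.trans_lt hx.1, hx.2⟩
    have hc := cos_pos' ⟨hx'.1.le, hx'.2⟩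
    refine ((hasDerivAt_cos_pow m x hc.ne').mul (int2 hp hx')).congr_deriv ?_
    ring
  obtain ⟨c, hc, he⟩ := exists_hasDerivAt_eq_slope (fun x => cos x ^ m * p₁ x) (fun _ => 0) ha.2
    ((continuous_cos.pow m).continuousOn.mul (hp.2.1.mono (Icc_subset_Icc_left ha.1))) hd
  have h0 : π / 2 - a ≠ 0 := by linarith [ha.2]
  have hcp := (pow_pos (cos_pos' ha) m).ne'
  rw [eq_div_iff h0] at he
  simp only [hp.2.2.2.2, mul_zero, zero_mul, zero_sub] at he
  have : cos a ^ m * p₁ a = 0 := by linarith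
  exact (mul_eq_zero.mp this).resolve_left hcp

lemma wr {m : ℕ} {μ : ℝ} {p p₁ : ℝ → ℝ} (hp : IsLegendre (m + 2) μ p p₁) {x : ℝ}
    (hx : x ∈ Ioo (0 : ℝ) (π / 2)) :
    HasDerivAt (fun x => cos x ^ m * (p₁ x * sin x - p x * cos x))
      (cos x ^ m * ((m + 1 - μ * (μ + m)) * (p x * sin x))) x := by
  have hc := cos_pos' ⟨hx.1.le, hx.2⟩
  have h := (hasDerivAt_cos_pow m x hc.ne').mul
    (((int2 hp hx).mul (hasDerivAt_sin x)).sub ((int1 hp hx).mul (hasDerivAt_cos x)))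
  refine h.congr_deriv ?_
  have ht : tan x * cos x = sin x := tan_mul_cos hc.ne'
  simp only [Pi.mul_apply, Pi.sub_apply]
  linear_combination (m * cos x ^ m * p x) * ht

lemma wrcont {m : ℕ} {μ : ℝ} {p p₁ : ℝ → ℝ} (hp : IsLegendre (m + 2) μ p p₁) :
    ContinuousOn (fun x => cos x ^ m * (p₁ x * sin x - p x * cos x)) (Icc 0 (π / 2)) :=
  (continuous_cos.pow m).continuousOn.mul
    ((hp.2.1.mul continuous_sin.continuousOn).sub ((contp hp).mul continuous_cos.continuousOn))

lemma pos_base {m : ℕ} {μ : ℝ} {p p₁ : ℝ → ℝ} (hμ : 0 ≤ μ) (hμ1 : μ < 1)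
    (hp : IsLegendre (m + 2) μ p p₁) : ∀ x ∈ Icc (0 : ℝ) (π / 2), 0 < p x := by
  by_contra! hcon
  have hScl : IsClosed (Icc (0 : ℝ) (π / 2) ∩ p ⁻¹' Iic 0) :=
    (contp hp).preimage_isClosed_of_isClosed isClosed_Icc isClosed_Iic
  have hSc : IsCompact (Icc (0 : ℝ) (π / 2) ∩ p ⁻¹' Iic 0) :=
    isCompact_Icc.of_isClosed_subset hScl inter_subset_left
  obtain ⟨x0, hx0, hx0'⟩ := hcon
  obtain ⟨a, ⟨haI, haS⟩, hamax⟩ := hSc.exists_isGreatest ⟨x0, hx0, hx0'⟩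
  have haS' : p a ≤ 0 := haS
  have hane : a ≠ π / 2 := by
    rintro rfl
    linarith [hp.2.2.2.1]
  have ha : a ∈ Ico (0 : ℝ) (π / 2) := ⟨haI.1, lt_of_le_of_ne haI.2 hane⟩
  have hpos : ∀ x ∈ Ioo a (π / 2), 0 < p x := by
    intro x hx
    by_contra! h
    have := hamax ⟨⟨ha.1.trans hx.1.le, hx.2.le⟩, h⟩
    linarith [hx.1]
  have hp1 : 0 ≤ p₁ a := by
    rcases hμ.eq_or_lt with h | h
    · subst h
      exact (derivZero hp ha).ge
    · exact (derivA h hp ha hpos).le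
  have hmono : StrictMonoOn (fun x => cos x ^ m * (p₁ x * sin x - p x * cos x))
      (Icc a (π / 2)) := by
    apply strictMonoOn_of_deriv_pos (convex_Icc _ _)
    · exact (wrcont hp).mono (Icc_subset_Icc_left ha.1)
    · intro x hx
      rw [interior_Icc] at hx
      have hx' : x ∈ Ioo (0 : ℝ) (π / 2) := ⟨ha.1.trans_lt hx.1, hx.2⟩
      have hc := cos_pos' ⟨hx'.1.le, hx'.2⟩
      have hs : 0 < sin x := sin_pos_of_pos_of_lt_pi hx'.1 (by linarith [hx'.2, pi_pos])
      rw [(wr hp hx').deriv]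
      have hm : (0 : ℝ) ≤ m := Nat.cast_nonneg m
      have hl : 0 < m + 1 - μ * (μ + m) := by nlinarith
      have := hpos x hx
      positivity
  have h := hmono ⟨le_rfl, ha.2.le⟩ ⟨ha.2.le, le_rfl⟩ ha.2
  simp only [hp.2.2.2.2, cos_pi_div_two, mul_zero, zero_mul, sub_zero] at h
  have hc := cos_pos' ha
  have hs : 0 ≤ sin a := sin_nonneg_of_nonneg_of_le_pi ha.1 (by linarith [ha.2, pi_pos])
  have : 0 ≤ cos a ^ m * (p₁ a * sin a - p a * cos a) := by
    apply mul_nonneg (by positivity)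
    nlinarith [mul_nonneg hp1 hs]
  linarith

/-- The case `μ = 1`: `p 0 = 0`. -/
lemma zero_one {m : ℕ} {p p₁ : ℝ → ℝ} (hp : IsLegendre (m + 2) 1 p p₁) : p 0 = 0 := by
  obtain ⟨c, hc, he⟩ := exists_hasDerivAt_eq_slope _ (fun _ => 0) (by positivity : 0 < π / 2)
    (wrcont hp) (fun x hx => (wr hp hx).congr_deriv (by ring))
  rw [eq_div_iff (by have := pi_pos; linarith)] at he
  simp [hp.2.2.2.2] at he
  exact he.symm

lemma step {m : ℕ} {μ : ℝ} {p p₁ : ℝ → ℝ} (hμ : 1 ≤ μ) (hp : IsLegendre (m + 2) μ p p₁) :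
    IsLegendre (m + 2) (μ - 1) (fun x => sin x * p x + cos x * p₁ x / μ)
      (fun x => (μ + m - 1) * (sin x * p₁ x / μ - cos x * p x)) := by
  have hμ0 : μ ≠ 0 := by linarith
  have hcp := contp hp
  obtain ⟨h1, hc1, ⟨p₂, h2, hc2, ho⟩, hb, hb1⟩ := hp
  have hsub : Ico (0 : ℝ) (π / 2) ⊆ Icc 0 (π / 2) := Ico_subset_Icc_self
  have hc : ContinuousOn (fun x => sin x * p x + cos x * p₁ x / μ) (Icc 0 (π / 2)) := by
    fun_prop
  have hc' : ContinuousOn (fun x => (μ + m - 1) * (sin x * p₁ x / μ - cos x * p x))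
      (Icc 0 (π / 2)) := by
    fun_prop
  have hd : ∀ x ∈ Ico (0 : ℝ) (π / 2),
      HasDerivWithinAt (fun x => sin x * p x + cos x * p₁ x / μ)
        ((μ + m - 1) * (sin x * p₁ x / μ - cos x * p x)) (Ico 0 (π / 2)) x := by
    intro x hx
    have h := ((hasDerivAt_sin x).hasDerivWithinAt.mul ((h1 x (hsub hx)).mono hsub)).add
      (((hasDerivAt_cos x).hasDerivWithinAt.mul (h2 x hx)).div_const μ)
    refine h.congr_deriv ?_
    have ht : tan x * cos x = sin x := tan_mul_cos (cos_pos' hx).ne'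
    have := ho x hx
    push_cast at this
    field_simp
    linear_combination cos x * this + m * p₁ x * ht
  refine ⟨?_, hc', ⟨fun x => (μ + m - 1) * ((cos x * p₁ x + sin x * p₂ x) / μ -
      (-sin x * p x + cos x * p₁ x)), ?_, ?_, ?_⟩, ?_, ?_⟩
  · intro x hx
    rcases hx.2.eq_or_lt with h | h
    · subst h
      have hpi : (0 : ℝ) < π / 2 := by positivity
      have hnh : Ioo (0 : ℝ) (π / 2) ∈ nhdsWithin (π / 2) (Iio (π / 2)) := Ioo_mem_nhdsLT hpi
      refine HasDerivWithinAt.mono (t := Iic (π / 2)) ?_ Icc_subset_Iic_self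
      have hder : ∀ x ∈ Ioo (0 : ℝ) (π / 2),
          HasDerivAt (fun x => sin x * p x + cos x * p₁ x / μ)
            ((μ + m - 1) * (sin x * p₁ x / μ - cos x * p x)) x := fun x hx =>
        (hd x ⟨hx.1.le, hx.2⟩).hasDerivAt (Ico_mem_nhds hx.1 hx.2)
      apply hasDerivWithinAt_Iic_of_tendsto_deriv (s := Ioo 0 (π / 2))
      · exact fun x hx => (hder x hx).differentiableAt.differentiableWithinAt
      · exact (hc _ hx).mono Ioo_subset_Icc_self
      · exact hnh
      · have ht : Tendsto (fun x => (μ + m - 1) * (sin x * p₁ x / μ - cos x * p x))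
            (nhdsWithin (π / 2) (Iio (π / 2)))
            (nhds ((μ + m - 1) * (sin (π / 2) * p₁ (π / 2) / μ - cos (π / 2) * p (π / 2)))) := by
          have := (hc' _ hx).mono (Ioo_subset_Icc_self)
          rw [ContinuousWithinAt, nhdsWithin_Ioo_eq_nhdsLT hpi] at this
          exact this
        refine ht.congr' ?_
        filter_upwards [hnh] with x hx
        exact (hder x hx).deriv.symm
    · exact (hd x ⟨hx.1, h⟩).mono_of_mem_nhdsWithin
        (mem_of_superset (inter_mem_nhdsWithin _ (Iio_mem_nhds h)) fun y hy => ⟨hy.1.1, hy.2⟩)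
  · intro x hx
    have hp1 := (h1 x (hsub hx)).mono hsub
    have h := ((((hasDerivAt_sin x).hasDerivWithinAt.mul (h2 x hx)).div_const μ).sub
      ((hasDerivAt_cos x).hasDerivWithinAt.mul hp1)).const_mul (μ + m - 1)
    exact h
  · have a1 := hcp.mono hsub
    have a2 := hc1.mono hsub
    fun_prop
  · intro x hx
    have ht : tan x * cos x = sin x := tan_mul_cos (cos_pos' hx).ne'
    have := ho x hx
    push_cast at this ⊢
    field_simp
    linear_combination (μ + m - 1) * sin x * this + (μ + m - 1) * m * μ * p x * ht
  · simp [hb]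
  · simp [hb1]

lemma sign_mul_pos {a b : ℝ} (ha : 0 < a) : Real.sign (a * b) = Real.sign b := by
  rcases lt_trichotomy b 0 with h | h | h
  · rw [Real.sign_of_neg h, Real.sign_of_neg (mul_neg_of_pos_of_neg ha h)]
  · simp [h]
  · rw [Real.sign_of_pos h, Real.sign_of_pos (mul_pos ha h)]

lemma main (m k : ℕ) : ∀ (μ : ℝ) (_ : 0 ≤ μ) (_ : μ < k + 1)
    (p p₁ : ℝ → ℝ) (_ : IsLegendre (m + 2) μ p p₁),
    Real.sign (p 0) = Real.sign (Real.cos (μ * π / 2)) ∧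
    Real.sign (p₁ 0) = Real.sign (Real.sin (μ * π / 2)) := by
  have hpi := pi_pos
  have base : ∀ (μ : ℝ) (_ : 0 ≤ μ) (_ : μ < 1)
    (p p₁ : ℝ → ℝ) (_ : IsLegendre (m + 2) μ p p₁),
    Real.sign (p 0) = Real.sign (Real.cos (μ * π / 2)) ∧
    Real.sign (p₁ 0) = Real.sign (Real.sin (μ * π / 2)) := by
    intro μ h0 h1 p p₁ hp
    have hpos := pos_base h0 h1 hp
    have hz : (0 : ℝ) ∈ Ico 0 (π / 2) := ⟨le_rfl, by positivity⟩
    constructor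
    · rw [Real.sign_of_pos (hpos 0 ⟨le_rfl, by positivity⟩), Real.sign_of_pos]
      exact cos_pos' ⟨by positivity, by nlinarith⟩
    · rcases h0.eq_or_lt with h | h
      · subst h
        simp [derivZero hp hz]
      · rw [Real.sign_of_pos (derivA h hp hz fun x hx => hpos x ⟨hx.1.le, hx.2.le⟩),
          Real.sign_of_pos]
        exact sin_pos_of_pos_of_lt_pi (by positivity) (by nlinarith)
  induction k with
  | zero => simpa using base
  | succ k ih =>
    intro μ h0 h1 p p₁ hp
    rcases lt_or_ge μ 1 with h | h
    · exact base μ h0 h p p₁ hp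
    obtain ⟨e1, e2⟩ := ih (μ - 1) (by linarith) (by push_cast at h1; linarith) _ _ (step h hp)
    have a1 : (μ - 1) * π / 2 = μ * π / 2 - π / 2 := by ring
    rw [a1] at e1 e2
    rw [cos_sub_pi_div_two] at e1
    rw [sin_sub_pi_div_two] at e2
    simp only [sin_zero, cos_zero, zero_mul, zero_add, one_mul, zero_div, zero_sub] at e1 e2
    constructor
    · have hm : (0 : ℝ) ≤ m := Nat.cast_nonneg m
      rcases h.eq_or_lt with h' | h'
      · subst h'
        simp [zero_one hp]
      · rw [sign_mul_pos (by linarith), Real.sign_neg, Real.sign_neg] at e2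
        linarith
    · rw [div_eq_inv_mul, sign_mul_pos (by positivity)] at e1
      exact e1

end LegendreAux

/-- **Proposition 2.1(a).** The signs of `p_μ(0)` and `p_μ'(0)` are given by
`cos(μπ/2)` and `sin(μπ/2)` respectively. -/
theorem legendre_signs (n : ℕ) (hn : 2 ≤ n) (μ : ℝ) (hμ : 0 ≤ μ)
    (p p₁ : ℝ → ℝ) (hp : IsLegendre n μ p p₁) :
    Real.sign (p 0) = Real.sign (Real.cos (μ * π / 2)) ∧
    Real.sign (p₁ 0) = Real.sign (Real.sin (μ * π / 2)) := by
  obtain ⟨m, rfl⟩ := Nat.exists_eq_add_of_le' hn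
  exact LegendreAux.main m ⌊μ⌋₊ μ hμ (Nat.lt_floor_add_one μ) p p₁ hp
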